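/- arXiv:2311.01578 — 3 statements merged into one kernel-verified Lean document; each statement's English description precedes it below -/
import Mathlib

section
/- For every c₀ ∈ ℝ with c₀ ≠ −1 and every pair of real numbers a < b, there exists an infinitely differentiable, compactly supported function u₀ : ℝ → ℝ, not identically zero, such that u₀(x) = c₀ for all x ∈ (a,b), and ∫_ℝ K(x−y)·(u₀(y) + u₀(y)²/2) dy = 0 for every x ∈ (a,b). -/
open MeasureTheory Real

/-- The kernel `K(x) = -sgn(x) e^{-|x|}/2`, the derivative of the Green's function
`G₂(x) = e^{-|x|}/2` of `1 - d²/dx²` on `ℝ`. -/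
noncomputable def bbmK (x : ℝ) : ℝ := -Real.sign x * Real.exp (-|x|) / 2

lemma bbm_int_exp_neg (p q : ℝ) :
    ∫ y in p..q, Real.exp (-y) = Real.exp (-p) - Real.exp (-q) := by
  rw [intervalIntegral.integral_comp_neg (fun y => Real.exp y)]
  exact integral_exp

lemma bbm_conv_zero (L T M : ℝ) (hLT : L ≤ T) (v : ℝ → ℝ) (hv : Continuous v)
    (heven : ∀ y, v (-y) = v y) (hM : ∀ y, |y| ≤ L → v y = M) (hT : ∀ y, T ≤ |y| → v y = 0)
    (hint : ∫ y in L..T, Real.exp (-y) * v y = M * Real.exp (-L))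
    (x : ℝ) (hx : |x| < L) : ∫ y : ℝ, bbmK (x - y) * v y = 0 := by
  obtain ⟨hx1, hx2⟩ := abs_lt.mp hx
  have hc : Continuous fun y => Real.exp (-y) * v y := by fun_prop
  have hc' : Continuous fun y => Real.exp y * v y := by fun_prop
  have J : ∀ z, |z| < L → ∫ y in z..T, Real.exp (-y) * v y = M * Real.exp (-z) := by
    intro z hz
    obtain ⟨hz1, hz2⟩ := abs_lt.mp hz
    rw [← intervalIntegral.integral_add_adjacent_intervals (hc.intervalIntegrable z L)
      (hc.intervalIntegrable L T), hint]
    have : ∫ y in z..L, Real.exp (-y) * v y = ∫ y in z..L, Real.exp (-y) * M := by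
      apply intervalIntegral.integral_congr_Ioo_of_le hz2.le
      intro y hy
      simp only
      rw [hM y (abs_le.mpr ⟨by linarith [hy.1], hy.2.le⟩)]
    rw [this, intervalIntegral.integral_mul_const, bbm_int_exp_neg]
    ring
  have h0 : ∫ y : ℝ, bbmK (x - y) * v y = ∫ y in (-T)..T, bbmK (x - y) * v y := by
    rw [intervalIntegral.integral_of_le (by linarith),
      ← integral_Icc_eq_integral_Ioc, setIntegral_eq_integral_of_forall_compl_eq_zero]
    intro y hy
    rw [hT y, mul_zero]
    by_contra h
    push Not at h
    exact hy ⟨(abs_lt.mp h).1.le, (abs_lt.mp h).2.le⟩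
  have e1 : Set.EqOn (fun y => bbmK (x - y) * v y)
      (fun y => (-Real.exp (-x) / 2) * (Real.exp y * v y)) (Set.Ioo (-T) x) := by
    intro y hy
    have : 0 < x - y := by linarith [hy.2]
    simp only [bbmK]
    rw [Real.sign_of_pos this, abs_of_pos this,
      show -(x - y) = -x + y by ring, Real.exp_add]
    ring
  have e2 : Set.EqOn (fun y => bbmK (x - y) * v y)
      (fun y => (Real.exp x / 2) * (Real.exp (-y) * v y)) (Set.Ioo x T) := by
    intro y hy
    have : x - y < 0 := by linarith [hy.1]
    simp only [bbmK]
    rw [Real.sign_of_neg this, abs_of_neg this,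
      show - -(x - y) = x + -y by ring, Real.exp_add]
    ring
  have i1 : IntervalIntegrable (fun y => bbmK (x - y) * v y) volume (-T) x := by
    refine IntervalIntegrable.congr_uIoo ((hc'.const_mul (-Real.exp (-x) / 2)).intervalIntegrable _ _) ?_
    rw [Set.uIoo_of_le (by linarith)]
    exact e1.symm
  have i2 : IntervalIntegrable (fun y => bbmK (x - y) * v y) volume x T := by
    refine IntervalIntegrable.congr_uIoo ((hc.const_mul (Real.exp x / 2)).intervalIntegrable _ _) ?_
    rw [Set.uIoo_of_le (by linarith)]
    exact e2.symm
  have hrefl : ∫ y in (-T)..x, Real.exp y * v y = ∫ y in (-x)..T, Real.exp (-y) * v y := by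
    have := intervalIntegral.integral_comp_neg (a := -x) (b := T) (fun y => Real.exp y * v y)
    simp only [heven, neg_neg] at this
    exact this.symm
  rw [h0, ← intervalIntegral.integral_add_adjacent_intervals i1 i2,
    intervalIntegral.integral_congr_Ioo_of_le (by linarith) e1,
    intervalIntegral.integral_congr_Ioo_of_le (by linarith) e2,
    intervalIntegral.integral_const_mul, intervalIntegral.integral_const_mul, hrefl,
    J x hx, J (-x) (by rwa [abs_neg]), neg_neg, Real.exp_neg]
  field_simp
  ring

lemma bbm_bump (r : ℝ) (hr : 0 < r) : ∃ χ : ℝ → ℝ, ContDiff ℝ (⊤ : ℕ∞) χ ∧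
    (∀ y, χ (-y) = χ y) ∧ (∀ y, 0 ≤ χ y) ∧ (∀ y, χ y ≤ 1) ∧ (∀ y, |y| ≤ r → χ y = 1) ∧
    (∀ y, r + 1 ≤ |y| → χ y = 0) := by
  let f : ContDiffBump (0 : ℝ) := ⟨r, r + 1, hr, by linarith⟩
  refine ⟨f, f.contDiff, f.neg, f.nonneg', fun y => f.le_one, fun y hy => ?_, fun y hy => ?_⟩
  · apply f.one_of_mem_closedBall
    simpa using hy
  · apply f.zero_of_le_dist
    simpa using hy

lemma bbm_exists_even (c L : ℝ) (hc : c ≠ -1) (hL : 0 < L) :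
    ∃ (u : ℝ → ℝ) (T : ℝ), L ≤ T ∧ ContDiff ℝ (⊤ : ℕ∞) u ∧ (∀ y, u (-y) = u y) ∧
      (∀ y, |y| ≤ L → u y = c) ∧ (∀ y, T ≤ |y| → u y = 0) ∧ (∃ y, u y ≠ 0) ∧
      ∫ y in L..T, Real.exp (-y) * (u y + u y ^ 2 / 2) = (c + c ^ 2 / 2) * Real.exp (-L) := by
  have hc1 : 0 < (c + 1) ^ 2 := by
    have : c + 1 ≠ 0 := fun h => hc (by linarith)
    positivity
  obtain ⟨r, hr0, hr⟩ : ∃ r : ℝ, 0 < r ∧ Real.exp (-r) < (c + 1) ^ 2 := by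
    refine ⟨1 / (c + 1) ^ 2, by positivity, ?_⟩
    have h := Real.add_one_le_exp (1 / (c + 1) ^ 2)
    rw [Real.exp_neg]
    apply inv_lt_of_inv_lt₀ hc1
    rw [← one_div]
    linarith
  obtain ⟨R, hR⟩ : ∃ R, R = L + 1 + r := ⟨_, rfl⟩
  have hexpR : Real.exp (-R) < (c + 1) ^ 2 * Real.exp (-(L + 1)) := by
    rw [hR, neg_add, Real.exp_add, mul_comm]
    exact mul_lt_mul_of_pos_right hr (Real.exp_pos _)
  obtain ⟨χ, hχ, χe, χ0, χ1, χi, χo⟩ := bbm_bump L hL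
  obtain ⟨η, hη, ηe, η0, η1, ηi, ηo⟩ := bbm_bump R (by linarith)
  obtain ⟨α, hα, αe, α0, α1, αi, αo⟩ := bbm_bump (R + 2) (by linarith)
  obtain ⟨β, hβ, βe, β0, β1, βi, βo⟩ := bbm_bump (R + 3) (by linarith)
  obtain ⟨T, hT⟩ : ∃ T, T = R + 4 := ⟨_, rfl⟩
  obtain ⟨w, hw⟩ : ∃ w : ℝ → ℝ, w = fun y => (c + 1) * χ y - η y := ⟨_, rfl⟩
  obtain ⟨ψ, hψ⟩ : ∃ ψ : ℝ → ℝ, ψ = fun y => β y - α y := ⟨_, rfl⟩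
  have hws : ContDiff ℝ (⊤ : ℕ∞) w := by rw [hw]; fun_prop
  have hψs : ContDiff ℝ (⊤ : ℕ∞) ψ := by rw [hψ]; fun_prop
  have hwc := hws.continuous
  have hψc := hψs.continuous
  have hψ0 : ∀ y, |y| ≤ R + 2 → ψ y = 0 := by
    intro y hy
    rw [hψ]; simp only
    rw [βi y (by linarith), αi y hy, sub_self]
  have hdis : ∀ y, w y * ψ y = 0 := by
    intro y
    by_cases hy : |y| ≤ R + 2
    · rw [hψ0 y hy, mul_zero]
    · push Not at hy
      rw [hw]; simp only
      rw [χo y (by linarith), ηo y (by linarith)]; ring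
  -- negativity
  have hv : Continuous fun y => Real.exp (-y) * (w y + w y ^ 2 / 2) := by fun_prop
  have hec : Continuous fun y : ℝ => Real.exp (-y) := by fun_prop
  have n1 : ∫ y in L..(L + 1), Real.exp (-y) * (w y + w y ^ 2 / 2) ≤
      (Real.exp (-L) - Real.exp (-(L + 1))) * (c + c ^ 2 / 2) := by
    rw [← bbm_int_exp_neg, ← intervalIntegral.integral_mul_const]
    apply intervalIntegral.integral_mono_on (by linarith) (hv.intervalIntegrable _ _)
      ((hec.mul continuous_const).intervalIntegrable _ _)
    intro y hy
    apply mul_le_mul_of_nonneg_left _ (Real.exp_pos _).le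
    have hy' : |y| = y := abs_of_nonneg (by linarith [hy.1])
    rw [hw]; simp only
    rw [ηi y (by rw [hy']; linarith [hy.2])]
    have : χ y ^ 2 ≤ 1 := pow_le_one₀ (χ0 y) (χ1 y)
    nlinarith [mul_le_mul_of_nonneg_left this hc1.le]
  have n2 : ∫ y in (L + 1)..R, Real.exp (-y) * (w y + w y ^ 2 / 2) ≤
      (Real.exp (-(L + 1)) - Real.exp (-R)) * (-1 / 2) := by
    rw [← bbm_int_exp_neg, ← intervalIntegral.integral_mul_const]
    apply intervalIntegral.integral_mono_on (by linarith) (hv.intervalIntegrable _ _)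
      ((hec.mul continuous_const).intervalIntegrable _ _)
    intro y hy
    apply mul_le_mul_of_nonneg_left _ (Real.exp_pos _).le
    have hy' : |y| = y := abs_of_nonneg (by linarith [hy.1])
    rw [hw]; simp only
    rw [ηi y (by rw [hy']; linarith [hy.2]), χo y (by rw [hy']; linarith [hy.1])]
    norm_num
  have n3 : ∫ y in R..T, Real.exp (-y) * (w y + w y ^ 2 / 2) ≤
      (Real.exp (-R) - Real.exp (-T)) * 0 := by
    rw [← bbm_int_exp_neg, ← intervalIntegral.integral_mul_const]
    apply intervalIntegral.integral_mono_on (by linarith) (hv.intervalIntegrable _ _)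
      ((hec.mul continuous_const).intervalIntegrable _ _)
    intro y hy
    apply mul_le_mul_of_nonneg_left _ (Real.exp_pos _).le
    have hy' : |y| = y := abs_of_nonneg (by linarith [hy.1])
    rw [hw]; simp only
    rw [χo y (by rw [hy']; linarith [hy.1])]
    nlinarith [η0 y, η1 y]
  obtain ⟨A, hA⟩ : ∃ A, A = ∫ y in L..T, Real.exp (-y) * (w y + w y ^ 2 / 2) := ⟨_, rfl⟩
  obtain ⟨B, hB⟩ : ∃ B, B = ∫ y in L..T, Real.exp (-y) * ψ y := ⟨_, rfl⟩
  obtain ⟨C, hC⟩ : ∃ C, C = ∫ y in L..T, Real.exp (-y) * (ψ y ^ 2 / 2) := ⟨_, rfl⟩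
  have hAneg : A < (c + c ^ 2 / 2) * Real.exp (-L) := by
    rw [hA, ← intervalIntegral.integral_add_adjacent_intervals (hv.intervalIntegrable L R)
      (hv.intervalIntegrable R T),
      ← intervalIntegral.integral_add_adjacent_intervals (hv.intervalIntegrable L (L + 1))
      (hv.intervalIntegrable (L + 1) R)]
    nlinarith
  have hψ2 : Continuous fun y => Real.exp (-y) * (ψ y ^ 2 / 2) := by fun_prop
  have hψ1 : Continuous fun y => Real.exp (-y) * ψ y := by fun_prop
  have hCpos : 0 < C := by
    rw [hC]
    apply intervalIntegral.integral_pos (by linarith) hψ2.continuousOn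
    · intro y _; positivity
    · refine ⟨R + 3, ⟨by linarith, by linarith⟩, ?_⟩
      have hab : |R + 3| = R + 3 := abs_of_nonneg (by linarith)
      have : ψ (R + 3) = 1 := by
        rw [hψ]; simp only
        rw [βi _ (by rw [hab]), αo _ (by rw [hab]; linarith)]; ring
      rw [this]; positivity
  obtain ⟨t, ht⟩ : ∃ t, C * (t * t) + B * t + (A - (c + c ^ 2 / 2) * Real.exp (-L)) = 0 := by
    apply exists_quadratic_eq_zero hCpos.ne'
    refine ⟨√(discrim C B (A - (c + c ^ 2 / 2) * Real.exp (-L))), ?_⟩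
    rw [Real.mul_self_sqrt]
    unfold discrim
    nlinarith [sq_nonneg B, mul_pos hCpos (sub_pos.mpr hAneg)]
  refine ⟨fun y => w y + t * ψ y, T, by linarith, by fun_prop, ?_, ?_, ?_, ⟨R, ?_⟩, ?_⟩
  · intro y
    simp only [hw, hψ, χe, ηe, αe, βe]
  · intro y hy
    simp only
    rw [hψ0 y (by linarith), hw]; simp only
    rw [χi y hy, ηi y (by linarith)]; ring
  · intro y hy
    simp only [hw, hψ]
    rw [χo y (by linarith), ηo y (by linarith), αo y (by linarith), βo y (by linarith)]; ring
  · have hab : |R| = R := abs_of_nonneg (by linarith)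
    simp only
    rw [hψ0 R (by rw [hab]; linarith), hw]; simp only
    rw [χo R (by rw [hab]; linarith), ηi R (by rw [hab])]; norm_num
  · have : ∀ y, Real.exp (-y) * ((w y + t * ψ y) + (w y + t * ψ y) ^ 2 / 2) =
        Real.exp (-y) * (w y + w y ^ 2 / 2) + t * (Real.exp (-y) * ψ y) +
          (t * t) * (Real.exp (-y) * (ψ y ^ 2 / 2)) := by
      intro y
      linear_combination Real.exp (-y) * t * hdis y
    simp only [this]
    have hv1 : Continuous fun y => Real.exp (-y) * (w y + w y ^ 2 / 2) +
        t * (Real.exp (-y) * ψ y) := by fun_prop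
    rw [intervalIntegral.integral_add
      (hv1.intervalIntegrable _ _)
      ((hψ2.const_mul (t * t)).intervalIntegrable _ _),
      intervalIntegral.integral_add (hv.intervalIntegrable _ _)
      ((hψ1.const_mul t).intervalIntegrable _ _),
      intervalIntegral.integral_const_mul, intervalIntegral.integral_const_mul,
      ← hA, ← hB, ← hC]
    linarith

/-- For any `c₀ ≠ -1` and `a < b` there is a nonzero smooth compactly supported `u₀` equal to
`c₀` on `(a,b)` with `∫ K(x-y)(u₀+u₀²/2) dy = 0` (i.e. `∂ₜu(x,0) = 0`) for all `x ∈ (a,b)`. -/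
theorem bbm_failure_of_uc_for_other_constants (c₀ : ℝ) (hc : c₀ ≠ -1)
    (a b : ℝ) (hab : a < b) :
    ∃ u₀ : ℝ → ℝ, ContDiff ℝ (⊤ : ℕ∞) u₀ ∧ HasCompactSupport u₀ ∧ u₀ ≠ 0 ∧
      (∀ x ∈ Set.Ioo a b, u₀ x = c₀) ∧
      (∀ x ∈ Set.Ioo a b, (∫ y : ℝ, bbmK (x - y) * (u₀ y + u₀ y ^ 2 / 2)) = 0) := by
  obtain ⟨u, T, hLT, hu, heven, hin, hout, ⟨y₀, hy₀⟩, hint⟩ :=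
    bbm_exists_even c₀ ((b - a) / 2) hc (by linarith)
  obtain ⟨m, hm⟩ : ∃ m, m = (a + b) / 2 := ⟨_, rfl⟩
  have habs : ∀ x ∈ Set.Ioo a b, |x - m| < (b - a) / 2 := by
    intro x hx
    rw [abs_lt]
    constructor <;> linarith [hx.1, hx.2]
  have huc := hu.continuous
  refine ⟨fun x => u (x - m), by fun_prop, ?_, ?_, ?_, ?_⟩
  · apply HasCompactSupport.of_support_subset_isCompact (isCompact_Icc (a := m - T) (b := m + T))
    intro x hx
    by_contra h
    apply hx
    apply hout
    by_contra h2
    push Not at h2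
    rw [abs_lt] at h2
    exact h ⟨by linarith [h2.1], by linarith [h2.2]⟩
  · intro h
    apply hy₀
    simpa using congrFun h (y₀ + m)
  · intro x hx
    exact hin _ (habs x hx).le
  · intro x hx
    have h := bbm_conv_zero ((b - a) / 2) T (c₀ + c₀ ^ 2 / 2) hLT
      (fun y => u y + u y ^ 2 / 2) (by fun_prop) (by intro y; simp only [heven])
      (by intro y hy; simp only [hin y hy]) (by intro y hy; simp [hout y hy]) hint
      (x - m) (habs x hx)
    rw [← integral_sub_right_eq_self _ m] at h
    rw [← h]
    congr 1
    ext y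
    simp only
    rw [show x - m - (y - m) = x - y by ring]
end

section
/- Let f(y) = y + y²/2. For every c₀ ∈ ℝ with c₀ ≠ −1, there exist 0 < a < b < 1 and an infinitely differentiable 1-periodic function u₀ : ℝ → ℝ, not identically equal to c₀, such that u₀(x) = c₀ for all x ∈ [a,b], and ∫₀¹ 𝒢′(a−y)·(f(u₀(y)) − f(c₀)) dy = ∫₀¹ 𝒢′(b−y)·(f(u₀(y)) − f(c₀)) dy. -/
open MeasureTheory Real

/-- The 1-periodic kernel `𝒢′(x) = sinh(x - ⌊x⌋ - 1/2)/(2 sinh(1/2))`, the derivative of the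
periodic Green's function of `1 - d²/dx²` on the circle `ℝ/ℤ`. -/
noncomputable def bbmGper' (x : ℝ) : ℝ :=
  Real.sinh (x - ↑⌊x⌋ - 1 / 2) / (2 * Real.sinh (1 / 2))

lemma bbm_odd (x : ℝ) (hx : Int.fract x ≠ 0) : bbmGper' (-x) = - bbmGper' x := by
  unfold bbmGper'
  rw [Int.self_sub_floor, Int.self_sub_floor, Int.fract_neg hx, ← neg_div, ← Real.sinh_neg]
  congr 2
  ring

noncomputable def bbmg (y : ℝ) : ℝ :=
  Real.sin (2 * π * y) * expNegInvGlue (Real.cos (2 * π * y)) / 2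

lemma bbmg_smooth : ContDiff ℝ (⊤ : ℕ∞) bbmg := by
  unfold bbmg
  have h1 : ContDiff ℝ (⊤ : ℕ∞) (fun y : ℝ => Real.cos (2 * π * y)) := by fun_prop
  have h2 : ContDiff ℝ (⊤ : ℕ∞) (fun y : ℝ => Real.sin (2 * π * y)) := by fun_prop
  have h3 : ContDiff ℝ (⊤ : ℕ∞) expNegInvGlue := expNegInvGlue.contDiff
  exact (h2.mul (h3.comp h1)).div_const 2

lemma bbmg_periodic (y : ℝ) : bbmg (y + 1) = bbmg y := by
  unfold bbmg
  rw [show 2 * π * (y + 1) = 2 * π * y + 2 * π by ring, Real.sin_add_two_pi, Real.cos_add_two_pi]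

lemma bbmg_refl (y : ℝ) : bbmg (1 - y) = - bbmg y := by
  unfold bbmg
  rw [show 2 * π * (1 - y) = 2 * π - 2 * π * y by ring, Real.sin_two_pi_sub, Real.cos_two_pi_sub]
  ring

lemma bbmg_lt (y : ℝ) : 0 < 1 + bbmg y := by
  have h0 := expNegInvGlue.nonneg (Real.cos (2 * π * y))
  have h1 : expNegInvGlue (Real.cos (2 * π * y)) ≤ 1 := by
    unfold expNegInvGlue
    split_ifs with h
    · norm_num
    · push Not at h
      rw [Real.exp_le_one_iff]
      have := inv_pos.2 h
      linarith
  have h2 := Real.neg_one_le_sin (2 * π * y)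
  unfold bbmg
  nlinarith

lemma bbmg_zero (y : ℝ) (h : Real.cos (2 * π * y) ≤ 0) : bbmg y = 0 := by
  unfold bbmg
  rw [expNegInvGlue.zero_of_nonpos h]
  simp

lemma bbmg_ne : bbmg (1 / 8) ≠ 0 := by
  unfold bbmg
  rw [show 2 * π * (1 / 8) = π / 4 by ring]
  have hs : 0 < Real.sin (π / 4) := by rw [Real.sin_pi_div_four]; positivity
  have hc : 0 < Real.cos (π / 4) := by rw [Real.cos_pi_div_four]; positivity
  have := expNegInvGlue.pos_of_pos hc
  positivity

/-- For any `c₀ ≠ -1` there are `0 < a < b < 1` and a smooth 1-periodic `u₀`, not identically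
`c₀`, with `u₀ = c₀` on `[a,b]` and, with `f(y) = y + y²/2`,
`∫₀¹ 𝒢′(a-y)(f(u₀)-f(c₀)) dy = ∫₀¹ 𝒢′(b-y)(f(u₀)-f(c₀)) dy`
(i.e. `∂ₜu(a,0) = ∂ₜu(b,0)`). -/
theorem bbm_failure_of_uc_periodic (c₀ : ℝ) (hc : c₀ ≠ -1) :
    ∃ a b : ℝ, 0 < a ∧ a < b ∧ b < 1 ∧
      ∃ u₀ : ℝ → ℝ, ContDiff ℝ (⊤ : ℕ∞) u₀ ∧ Function.Periodic u₀ 1 ∧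
        u₀ ≠ (fun _ => c₀) ∧ (∀ x ∈ Set.Icc a b, u₀ x = c₀) ∧
        (∫ y in (0:ℝ)..1, bbmGper' (a - y) * ((u₀ y + u₀ y ^ 2 / 2) - (c₀ + c₀ ^ 2 / 2))) =
          ∫ y in (0:ℝ)..1, bbmGper' (b - y) * ((u₀ y + u₀ y ^ 2 / 2) - (c₀ + c₀ ^ 2 / 2)) := by
  have hc1 : 1 + c₀ ≠ 0 := fun h => hc (by linarith)
  have key : ∀ y, ((-1 + (1 + c₀) * √(1 + bbmg y)) + (-1 + (1 + c₀) * √(1 + bbmg y)) ^ 2 / 2)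
      - (c₀ + c₀ ^ 2 / 2) = (1 + c₀) ^ 2 / 2 * bbmg y := by
    intro y
    have := Real.sq_sqrt (bbmg_lt y).le
    linear_combination (1 + c₀) ^ 2 / 2 * this
  refine ⟨1 / 4, 3 / 4, by norm_num, by norm_num, by norm_num,
    fun y => -1 + (1 + c₀) * √(1 + bbmg y), ?_, ?_, ?_, ?_, ?_⟩
  · exact contDiff_const.add (contDiff_const.mul
      ((contDiff_const.add bbmg_smooth).sqrt fun y => (bbmg_lt y).ne'))
  · intro y
    simp only [bbmg_periodic]
  · intro h
    have h1 := congrFun h (1 / 8)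
    have h2 := key (1 / 8)
    rw [h1, sub_self] at h2
    have : (1 + c₀) ^ 2 / 2 * bbmg (1 / 8) ≠ 0 := mul_ne_zero (by positivity) bbmg_ne
    exact this h2.symm
  · intro x hx
    have : bbmg x = 0 := by
      apply bbmg_zero
      apply Real.cos_nonpos_of_pi_div_two_le_of_le
      · nlinarith [hx.1, Real.pi_pos]
      · nlinarith [hx.2, Real.pi_pos]
    simp only [this]
    simp
  · simp only [key]
    have hs := intervalIntegral.integral_comp_sub_left (a := 0) (b := 1)
      (fun y => bbmGper' (3 / 4 - y) * ((1 + c₀) ^ 2 / 2 * bbmg y)) 1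
    simp only [sub_self, sub_zero] at hs
    rw [← hs]
    congr 1
    funext y
    rw [bbmg_refl, show (3 / 4 - (1 - y) : ℝ) = -(1 / 4 - y) by ring]
    by_cases hf : Int.fract (1 / 4 - y) = 0
    · have : bbmg y = 0 := by
        apply bbmg_zero
        obtain ⟨n, hn⟩ := Int.fract_eq_zero_iff.1 hf
        have : 2 * π * y = π / 2 - n * (2 * π) := by
          rw [hn]; ring
        rw [this, Real.cos_sub_int_mul_two_pi, Real.cos_pi_div_two]
      simp [this]
    · rw [bbm_odd _ hf]
      ring
end

section
/- Let k ∈ ℕ, θ ∈ [0,1], T > 0, u₀ ∈ C^{k,θ}(ℝ), and let u : ℝ × [−T,T] → ℝ be continuous with u(·,t) ∈ C^{k,θ}(ℝ) for each t and M := sup_{|t|≤T} ‖u(·,t)‖_{C^{k,θ}} < ∞, satisfying u(x,t) = u₀(x) − ∫₀ᵗ ∫_ℝ K(x−y)·(u(y,t′) + u(y,t′)²/2) dy dt′ for all (x,t) ∈ ℝ × [−T,T]. Then there is a constant c = c(k,θ) > 0 such that for each t ∈ [−T,T], the difference u(·,t) − u₀ belongs to C^{k+1,θ}(ℝ) with ‖u(·,t)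 − u₀‖_{C^{k+1,θ}} ≤ c·|t|·(M + M²). -/
open MeasureTheory Real
open scoped ENNReal NNReal

/-- The supremum norm `‖f‖_∞ = sup_x |f(x)|` (as a real-valued junk-tolerant `iSup`). -/
noncomputable def supNorm (f : ℝ → ℝ) : ℝ := ⨆ x : ℝ, |f x|

/-- The Hölder seminorm `sup_{h ≠ 0} sup_x |f⁽ᵏ⁾(x+h) - f⁽ᵏ⁾(x)| / |h|^θ`. -/
noncomputable def holderSeminorm (k : ℕ) (θ : ℝ) (f : ℝ → ℝ) : ℝ :=
  ⨆ h : {h : ℝ // h ≠ 0}, ⨆ x : ℝ,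
    |iteratedDeriv k f (x + ↑h) - iteratedDeriv k f x| / |(h : ℝ)| ^ θ

/-- The `C^{k,θ}` norm `‖f‖_{C^{k,θ}} = Σ_{j=0}^k ‖f⁽ʲ⁾‖_∞ + [f⁽ᵏ⁾]_θ`. -/
noncomputable def holderNorm (k : ℕ) (θ : ℝ) (f : ℝ → ℝ) : ℝ :=
  (∑ j ∈ Finset.range (k + 1), supNorm (iteratedDeriv j f)) + holderSeminorm k θ f

/-- Membership in the Hölder class `C^{k,θ}(ℝ)`: `f` is `k` times continuously
differentiable, all derivatives up to order `k` are bounded, and the `k`-th derivative is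
`θ`-Hölder continuous. -/
def MemHolderClass (k : ℕ) (θ : ℝ) (f : ℝ → ℝ) : Prop :=
  ContDiff ℝ (k : ℕ∞) f ∧
  (∀ j ≤ k, ∃ C : ℝ, ∀ x : ℝ, |iteratedDeriv j f x| ≤ C) ∧
  (∃ C : ℝ, ∀ x y : ℝ, |iteratedDeriv k f x - iteratedDeriv k f y| ≤ C * |x - y| ^ θ)

/-- Quantitative Hölder bound with a single constant. -/
def HB (k : ℕ) (θ A : ℝ) (f : ℝ → ℝ) : Prop :=
  ContDiff ℝ (k : ℕ) f ∧ (∀ j ≤ k, ∀ x : ℝ, |iteratedDeriv j f x| ≤ A) ∧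
  (∀ x y : ℝ, |iteratedDeriv k f x - iteratedDeriv k f y| ≤ A * |x - y| ^ θ)

lemma HB.nonneg {k : ℕ} {θ A : ℝ} {f : ℝ → ℝ} (h : HB k θ A f) : 0 ≤ A :=
  (abs_nonneg _).trans (h.2.1 0 (Nat.zero_le _) 0)

lemma holder_interp {f : ℝ → ℝ} {A B θ : ℝ} (hθ0 : 0 ≤ θ) (hθ1 : θ ≤ 1)
    (hf : Differentiable ℝ f) (hA : ∀ x, |f x| ≤ A) (hB : ∀ x, |deriv f x| ≤ B)
    (hAB : B ≤ 2 * A) (x y : ℝ) : |f x - f y| ≤ 2 * A * |x - y| ^ θ := by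
  have hA0 : 0 ≤ A := (abs_nonneg _).trans (hA 0)
  rcases le_total |x - y| 1 with h | h
  · have h1 : |f x - f y| ≤ B * |x - y| := by
      have := Convex.norm_image_sub_le_of_norm_deriv_le (f := f) (s := Set.univ) (x := y) (y := x)
        (C := B) (fun z _ => hf z) (fun z _ => hB z) convex_univ trivial trivial
      simpa using this
    rcases eq_or_ne (|x - y|) 0 with h0 | h0
    · rw [h0] at h1
      have : 0 ≤ 2 * A * |x - y| ^ θ := by positivity
      linarith
    have h2 : |x - y| ≤ |x - y| ^ θ := by
      have := Real.rpow_le_rpow_of_exponent_ge (lt_of_le_of_ne (abs_nonneg _) (Ne.symm h0)) h hθ1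
      simpa using this
    calc |f x - f y| ≤ B * |x - y| := h1
      _ ≤ 2 * A * |x - y| := by gcongr
      _ ≤ _ := by gcongr
  · have h2 : 1 ≤ |x - y| ^ θ := Real.one_le_rpow h hθ0
    have h3 : |f x - f y| ≤ |f x| + |f y| := abs_sub _ _
    nlinarith [hA x, hA y]

lemma HB_of_mem {k : ℕ} {θ M : ℝ} {f : ℝ → ℝ} (hf : MemHolderClass k θ f)
    (hM : holderNorm k θ f ≤ M) : HB k θ M f := by
  obtain ⟨h1, h2, C, hC⟩ := hf
  have hsup : ∀ g : ℝ → ℝ, 0 ≤ supNorm g := fun g => Real.iSup_nonneg fun x => abs_nonneg _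
  have hsem : 0 ≤ holderSeminorm k θ f :=
    Real.iSup_nonneg fun h => Real.iSup_nonneg fun x => by positivity
  unfold holderNorm at hM
  have hsum : 0 ≤ ∑ j ∈ Finset.range (k + 1), supNorm (iteratedDeriv j f) :=
    Finset.sum_nonneg fun _ _ => hsup _
  have hq : ∀ (h : {h : ℝ // h ≠ 0}) (x : ℝ),
      |iteratedDeriv k f (x + ↑h) - iteratedDeriv k f x| / |(h : ℝ)| ^ θ ≤ C := by
    intro h x
    have hh : 0 < |(h : ℝ)| ^ θ := Real.rpow_pos_of_pos (abs_pos.2 h.2) _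
    rw [div_le_iff₀ hh]
    have := hC (x + h) x
    simpa using this
  refine ⟨by exact_mod_cast h1, ?_, ?_⟩
  · intro j hj x
    obtain ⟨D, hD⟩ := h2 j hj
    have a1 : |iteratedDeriv j f x| ≤ supNorm (iteratedDeriv j f) :=
      le_ciSup (f := fun x => |iteratedDeriv j f x|) ⟨D, by rintro _ ⟨x, rfl⟩; exact hD x⟩ x
    have a2 : supNorm (iteratedDeriv j f) ≤ ∑ j ∈ Finset.range (k + 1), supNorm (iteratedDeriv j f) :=
      Finset.single_le_sum (f := fun j => supNorm (iteratedDeriv j f)) (fun _ _ => hsup _)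
        (Finset.mem_range.2 (by omega))
    linarith
  · intro x y
    have hM0 : 0 ≤ M := by linarith
    rcases eq_or_ne x y with rfl | hxy
    · simp only [sub_self, abs_zero]; positivity
    have hh : 0 < |x - y| ^ θ := Real.rpow_pos_of_pos (abs_pos.2 (sub_ne_zero.2 hxy)) _
    rw [← div_le_iff₀ hh]
    have b1 : |iteratedDeriv k f x - iteratedDeriv k f y| / |x - y| ^ θ ≤
        ⨆ z : ℝ, |iteratedDeriv k f (z + (x - y)) - iteratedDeriv k f z| / |x - y| ^ θ := by
      have := le_ciSup (f := fun z : ℝ =>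
        |iteratedDeriv k f (z + (x - y)) - iteratedDeriv k f z| / |x - y| ^ θ)
        ⟨C, by rintro _ ⟨z, rfl⟩; exact hq ⟨x - y, sub_ne_zero.2 hxy⟩ z⟩ y
      simpa using this
    have b2 : (⨆ z : ℝ, |iteratedDeriv k f (z + (x - y)) - iteratedDeriv k f z| / |x - y| ^ θ) ≤
        holderSeminorm k θ f :=
      le_ciSup (f := fun h : {h : ℝ // h ≠ 0} => ⨆ x : ℝ,
        |iteratedDeriv k f (x + ↑h) - iteratedDeriv k f x| / |(h : ℝ)| ^ θ)
        ⟨C, by rintro _ ⟨h, rfl⟩; exact ciSup_le (hq h)⟩ ⟨x - y, sub_ne_zero.2 hxy⟩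
    linarith

lemma HB.mem {k : ℕ} {θ A : ℝ} {f : ℝ → ℝ} (h : HB k θ A f) :
    MemHolderClass k θ f ∧ holderNorm k θ f ≤ (k + 2) * A := by
  have hA := h.nonneg
  obtain ⟨h1, h2, h3⟩ := h
  refine ⟨⟨by exact_mod_cast h1, fun j hj => ⟨A, h2 j hj⟩, A, h3⟩, ?_⟩
  have a1 : ∑ j ∈ Finset.range (k + 1), supNorm (iteratedDeriv j f) ≤ (k + 1) * A := by
    have := Finset.sum_le_card_nsmul (Finset.range (k + 1)) (fun j => supNorm (iteratedDeriv j f)) A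
      (fun j hj => ciSup_le (h2 j (by simpa [Nat.lt_succ_iff] using hj)))
    simpa using this
  have a2 : holderSeminorm k θ f ≤ A := by
    refine Real.iSup_le (fun h => ciSup_le fun x => ?_) hA
    have hh : 0 < |(h : ℝ)| ^ θ := Real.rpow_pos_of_pos (abs_pos.2 h.2) _
    rw [div_le_iff₀ hh]
    simpa using h3 (x + h) x
  unfold holderNorm
  linarith

lemma HB_nonlin {k : ℕ} {θ M : ℝ} {f : ℝ → ℝ} (hθ0 : 0 ≤ θ) (hθ1 : θ ≤ 1) (h : HB k θ M f) :
    HB k θ (2 ^ (k + 1) * (M + M ^ 2)) (fun x => f x + f x ^ 2 / 2) := by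
  have hM := h.nonneg
  obtain ⟨h1, h2, h3⟩ := h
  have hH : ∀ j ≤ k, ∀ x y, |iteratedDeriv j f x - iteratedDeriv j f y| ≤ 2 * M * |x - y| ^ θ := by
    intro j hj x y
    rcases hj.eq_or_lt with rfl | hj
    · have := h3 x y
      have h0 : 0 ≤ M * |x - y| ^ θ := by positivity
      linarith
    · refine holder_interp hθ0 hθ1 (h1.differentiable_iteratedDeriv j (by exact_mod_cast hj))
        (h2 j hj.le) (B := M) ?_ (by linarith) x y
      rw [← iteratedDeriv_succ]
      exact h2 (j + 1) hj
  have hform : ∀ j ≤ k, ∀ x, iteratedDeriv j (fun x => f x + f x ^ 2 / 2) x =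
      iteratedDeriv j f x + (1 / 2) * ∑ i ∈ Finset.range (j + 1),
        (j.choose i : ℝ) * iteratedDeriv i f x * iteratedDeriv (j - i) f x := by
    intro j hj x
    have hc : ContDiff ℝ (j : ℕ) f := h1.of_le (by exact_mod_cast hj)
    rw [← iteratedDeriv_fun_mul hc.contDiffAt hc.contDiffAt,
      ← iteratedDeriv_const_mul (1 / 2 : ℝ) (hc.mul hc).contDiffAt,
      ← iteratedDeriv_fun_add hc.contDiffAt (contDiff_const.mul (hc.mul hc)).contDiffAt]
    congr 1
    ext z
    ring
  have hp : ∀ j ≤ k, (∑ i ∈ Finset.range (j + 1), (j.choose i : ℝ)) ≤ 2 ^ k := by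
    intro j hj
    have : (∑ i ∈ Finset.range (j + 1), (j.choose i : ℝ)) = 2 ^ j := by
      exact_mod_cast Nat.sum_range_choose j
    rw [this]
    exact pow_le_pow_right₀ (by norm_num) hj
  have hone : (1 : ℝ) ≤ 2 ^ k := one_le_pow₀ (by norm_num)
  refine ⟨h1.add ((h1.pow 2).div_const 2), ?_, ?_⟩
  · intro j hj x
    rw [hform j hj]
    have hs : |∑ i ∈ Finset.range (j + 1),
        (j.choose i : ℝ) * iteratedDeriv i f x * iteratedDeriv (j - i) f x| ≤ 2 ^ k * M ^ 2 := by
      refine (Finset.abs_sum_le_sum_abs _ _).trans ?_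
      refine le_trans ?_ (mul_le_mul_of_nonneg_right (hp j hj) (sq_nonneg M))
      rw [Finset.sum_mul]
      refine Finset.sum_le_sum fun i hi => ?_
      have hi' : i ≤ j := by simpa [Nat.lt_succ_iff] using hi
      rw [abs_mul, abs_mul, Nat.abs_cast, mul_assoc, sq]
      gcongr
      · exact h2 i (by omega) x
      · exact h2 _ (by omega) x
    have ha := abs_add_le (iteratedDeriv j f x) ((1 / 2) * ∑ i ∈ Finset.range (j + 1),
        (j.choose i : ℝ) * iteratedDeriv i f x * iteratedDeriv (j - i) f x)
    rw [abs_mul, abs_of_pos (by norm_num : (0:ℝ) < 1 / 2)] at ha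
    have hb := h2 j hj x
    rw [pow_succ]
    nlinarith [mul_nonneg (sub_nonneg.2 hone) hM, mul_nonneg (sub_nonneg.2 hone) (sq_nonneg M), sq_nonneg M]
  · intro x y
    rw [hform k le_rfl, hform k le_rfl]
    set R := |x - y| ^ θ with hR
    have hR0 : 0 ≤ R := by positivity
    have hs : |∑ i ∈ Finset.range (k + 1),
          (k.choose i : ℝ) * iteratedDeriv i f x * iteratedDeriv (k - i) f x -
        ∑ i ∈ Finset.range (k + 1),
          (k.choose i : ℝ) * iteratedDeriv i f y * iteratedDeriv (k - i) f y|
        ≤ 2 ^ k * (4 * M ^ 2 * R) := by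
      rw [← Finset.sum_sub_distrib]
      refine (Finset.abs_sum_le_sum_abs _ _).trans ?_
      refine le_trans ?_ (mul_le_mul_of_nonneg_right (hp k le_rfl) (by positivity))
      rw [Finset.sum_mul]
      refine Finset.sum_le_sum fun i hi => ?_
      have hi' : i ≤ k := by simpa [Nat.lt_succ_iff] using hi
      have e : (k.choose i : ℝ) * iteratedDeriv i f x * iteratedDeriv (k - i) f x -
          (k.choose i : ℝ) * iteratedDeriv i f y * iteratedDeriv (k - i) f y =
          (k.choose i : ℝ) * ((iteratedDeriv i f x - iteratedDeriv i f y) * iteratedDeriv (k - i) f x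
            + iteratedDeriv i f y * (iteratedDeriv (k - i) f x - iteratedDeriv (k - i) f y)) := by ring
      rw [e, abs_mul, Nat.abs_cast]
      gcongr
      refine (abs_add_le _ _).trans ?_
      rw [abs_mul, abs_mul]
      have q1 := hH i hi' x y
      have q2 := hH (k - i) (by omega) x y
      have q3 := h2 i hi' y
      have q4 := h2 (k - i) (by omega) x
      calc _ ≤ (2 * M * R) * M + M * (2 * M * R) := by gcongr
        _ = _ := by ring
    have e2 : ∀ a b c d : ℝ, a + 1 / 2 * b - (c + 1 / 2 * d) = (a - c) + 1 / 2 * (b - d) := by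
      intros; ring
    rw [e2]
    refine (abs_add_le _ _).trans ?_
    rw [abs_mul, abs_of_pos (by norm_num : (0:ℝ) < 1 / 2)]
    have hb := h3 x y
    have hMR : 0 ≤ M * R := by positivity
    rw [pow_succ]
    nlinarith [mul_nonneg (sub_nonneg.2 hone) hMR]

lemma HB_conv {k : ℕ} {θ B : ℝ} {F H W : ℝ → ℝ} (hθ0 : 0 ≤ θ) (hθ1 : θ ≤ 1) (hF : HB k θ B F)
    (hH : ∀ x, HasDerivAt H (W x - F x) x) (hW : ∀ x, HasDerivAt W (H x) x)
    (hHB : ∀ x, |H x| ≤ B) (hWB : ∀ x, |W x| ≤ B) : HB (k + 1) θ ((2 * k + 5) * B) H := by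
  have hB := hF.nonneg
  obtain ⟨h1, h2, h3⟩ := hF
  have dH : deriv H = W - F := funext fun x => (hH x).deriv
  have dW : deriv W = H := funext fun x => (hW x).deriv
  have hcd : ∀ j ≤ k, ContDiff ℝ ((j + 1 : ℕ)) H ∧ ContDiff ℝ ((j + 1 : ℕ)) W := by
    have base : ContDiff ℝ 0 H ∧ ContDiff ℝ 0 W :=
      ⟨contDiff_zero.2 (continuous_iff_continuousAt.2 fun x => (hH x).continuousAt),
        contDiff_zero.2 (continuous_iff_continuousAt.2 fun x => (hW x).continuousAt)⟩
    have step : ∀ j ≤ k, ContDiff ℝ (j : ℕ) H ∧ ContDiff ℝ (j : ℕ) W →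
        ContDiff ℝ ((j + 1 : ℕ)) H ∧ ContDiff ℝ ((j + 1 : ℕ)) W := by
      intro j hj ⟨a, b⟩
      have hFj : ContDiff ℝ (j : ℕ) F := h1.of_le (by exact_mod_cast hj)
      push_cast
      rw [contDiff_succ_iff_deriv, contDiff_succ_iff_deriv, dH, dW]
      exact ⟨⟨fun x => (hH x).differentiableAt, by simp, b.sub hFj⟩,
        fun x => (hW x).differentiableAt, by simp, a⟩
    intro j
    induction j with
    | zero => intro h; exact step 0 h (by exact_mod_cast base)
    | succ j ih => intro h; exact step (j + 1) h (ih (by omega))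
  obtain ⟨cH, cW⟩ := hcd k le_rfl
  have iH : ∀ j ≤ k, ∀ x, iteratedDeriv (j + 1) H x = iteratedDeriv j W x - iteratedDeriv j F x := by
    intro j hj x
    rw [iteratedDeriv_succ', dH]
    exact iteratedDeriv_sub (cW.of_le (by exact_mod_cast (by omega : j ≤ k + 1))).contDiffAt
      (h1.of_le (by exact_mod_cast hj)).contDiffAt
  have iW : ∀ j x, iteratedDeriv (j + 1) W x = iteratedDeriv j H x := by
    intro j x
    rw [iteratedDeriv_succ', dW]
  have bd : ∀ j ≤ k + 1, ∀ x, |iteratedDeriv j H x| ≤ (j + 1) * B ∧ |iteratedDeriv j W x| ≤ (j + 1) * B := by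
    intro j
    induction j with
    | zero => intro _ x; simpa using ⟨hHB x, hWB x⟩
    | succ j ih =>
      intro hj x
      obtain ⟨a, b⟩ := ih (by omega) x
      rw [iH j (by omega), iW]
      have c := h2 j (by omega) x
      have d := abs_sub (iteratedDeriv j W x) (iteratedDeriv j F x)
      push_cast
      constructor <;> linarith
  refine ⟨cH, ?_, ?_⟩
  · intro j hj x
    refine (bd j hj x).1.trans ?_
    have : (j : ℝ) ≤ k + 1 := by exact_mod_cast hj
    exact mul_le_mul_of_nonneg_right (by linarith [(Nat.cast_nonneg k : (0:ℝ) ≤ k)]) hB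
  · intro x y
    rw [iH k le_rfl, iH k le_rfl]
    have a := holder_interp (f := iteratedDeriv k W) (A := (k + 2) * B) (B := (k + 1) * B) hθ0 hθ1
      (cW.differentiable_iteratedDeriv k (by exact_mod_cast Nat.lt_succ_self k))
      (fun x => (bd k (by omega) x).2.trans (by nlinarith))
      (fun x => by rw [← iteratedDeriv_succ, iW]; exact (bd k (by omega) x).1)
      (by nlinarith [mul_nonneg (Nat.cast_nonneg k : (0:ℝ) ≤ k) hB]) x y
    have b := h3 x y
    have e : iteratedDeriv k W x - iteratedDeriv k F x - (iteratedDeriv k W y - iteratedDeriv k F y)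
      = (iteratedDeriv k W x - iteratedDeriv k W y) - (iteratedDeriv k F x - iteratedDeriv k F y) := by
      ring
    rw [e]
    refine (abs_sub _ _).trans ?_
    linarith

lemma bbmK_neg_part {x y : ℝ} (h : y < x) : bbmK (x - y) = -(Real.exp (-x) * Real.exp y) / 2 := by
  unfold bbmK
  rw [Real.sign_of_pos (sub_pos.2 h), abs_of_pos (sub_pos.2 h), ← Real.exp_add]
  ring_nf

lemma bbmK_pos_part {x y : ℝ} (h : x < y) : bbmK (x - y) = (Real.exp x * Real.exp (-y)) / 2 := by
  unfold bbmK
  rw [Real.sign_of_neg (sub_neg.2 h), abs_of_neg (sub_neg.2 h), ← Real.exp_add]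
  ring_nf

lemma expF_intOn_Iic {F : ℝ → ℝ} {B : ℝ} (hc : Measurable F) (hB : ∀ x, |F x| ≤ B) (x : ℝ) :
    IntegrableOn (fun y => Real.exp y * F y) (Set.Iic x) := by
  refine Integrable.mono' ((integrableOn_exp_Iic x).mul_const B) (by fun_prop) ?_
  filter_upwards with y
  rw [Real.norm_eq_abs, abs_mul, Real.abs_exp]
  gcongr
  exact hB y

lemma expF_intOn_Ioi {F : ℝ → ℝ} {B : ℝ} (hc : Measurable F) (hB : ∀ x, |F x| ≤ B) (x : ℝ) :
    IntegrableOn (fun y => Real.exp (-y) * F y) (Set.Ioi x) := by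
  refine Integrable.mono' ((integrableOn_exp_neg_Ioi x).mul_const B) (by fun_prop) ?_
  filter_upwards with y
  rw [Real.norm_eq_abs, abs_mul, Real.abs_exp]
  gcongr
  exact hB y

lemma bbmK_int_Iic {F : ℝ → ℝ} {B : ℝ} (hc : Measurable F) (hB : ∀ x, |F x| ≤ B) (x : ℝ) :
    IntegrableOn (fun y => bbmK (x - y) * F y) (Set.Iic x) ∧
    ∫ y in Set.Iic x, bbmK (x - y) * F y =
      -(Real.exp (-x) * ∫ y in Set.Iic x, Real.exp y * F y) / 2 := by
  have e : (fun y => bbmK (x - y) * F y) =ᵐ[volume.restrict (Set.Iic x)]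
      fun y => (-Real.exp (-x) / 2) * (Real.exp y * F y) := by
    rw [← Measure.restrict_congr_set (Iio_ae_eq_Iic (a := x))]
    filter_upwards [ae_restrict_mem measurableSet_Iio] with y hy
    rw [bbmK_neg_part hy]; ring
  refine ⟨((expF_intOn_Iic hc hB x).const_mul _).congr e.symm, ?_⟩
  rw [integral_congr_ae e, integral_const_mul]
  ring

lemma bbmK_int_Ioi {F : ℝ → ℝ} {B : ℝ} (hc : Measurable F) (hB : ∀ x, |F x| ≤ B) (x : ℝ) :
    IntegrableOn (fun y => bbmK (x - y) * F y) (Set.Ioi x) ∧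
    ∫ y in Set.Ioi x, bbmK (x - y) * F y =
      (Real.exp x * ∫ y in Set.Ioi x, Real.exp (-y) * F y) / 2 := by
  have e : (fun y => bbmK (x - y) * F y) =ᵐ[volume.restrict (Set.Ioi x)]
      fun y => (Real.exp x / 2) * (Real.exp (-y) * F y) := by
    filter_upwards [ae_restrict_mem measurableSet_Ioi] with y hy
    rw [bbmK_pos_part hy]; ring
  refine ⟨((expF_intOn_Ioi hc hB x).const_mul _).congr e.symm, ?_⟩
  rw [integral_congr_ae e, integral_const_mul]
  ring

lemma bbmK_integrable {F : ℝ → ℝ} {B : ℝ} (hc : Measurable F) (hB : ∀ x, |F x| ≤ B) (x : ℝ) :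
    Integrable (fun y => bbmK (x - y) * F y) := by
  have := (bbmK_int_Iic hc hB x).1.union (bbmK_int_Ioi hc hB x).1
  rwa [Set.Iic_union_Ioi, integrableOn_univ] at this

lemma conv_exists {F : ℝ → ℝ} {B : ℝ} (hc : Continuous F) (hB : ∀ x, |F x| ≤ B) :
    ∃ W : ℝ → ℝ,
      (∀ x, HasDerivAt (fun x => ∫ y, bbmK (x - y) * F y) (W x - F x) x) ∧
      (∀ x, HasDerivAt W (∫ y, bbmK (x - y) * F y) x) ∧
      (∀ x, |∫ y, bbmK (x - y) * F y| ≤ B) ∧ (∀ x, |W x| ≤ B) := by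
  set P : ℝ → ℝ := fun x => Real.exp (-x) * ∫ y in Set.Iic x, Real.exp y * F y with hP
  set Q : ℝ → ℝ := fun x => Real.exp x * ∫ y in Set.Ioi x, Real.exp (-y) * F y with hQ
  have hm := hc.measurable
  have hH : ∀ x, ∫ y, bbmK (x - y) * F y = (Q x - P x) / 2 := by
    intro x
    rw [← setIntegral_univ, ← Set.Iic_union_Ioi (a := x),
      setIntegral_union (Set.Iic_disjoint_Ioi le_rfl) measurableSet_Ioi
        (bbmK_int_Iic hm hB x).1 (bbmK_int_Ioi hm hB x).1,
      (bbmK_int_Iic hm hB x).2, (bbmK_int_Ioi hm hB x).2]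
    simp only [hP, hQ]
    ring
  have hPB : ∀ x, |P x| ≤ B := by
    intro x
    have : ‖∫ y in Set.Iic x, Real.exp y * F y‖ ≤ ∫ y in Set.Iic x, Real.exp y * B := by
      refine norm_integral_le_of_norm_le ((integrableOn_exp_Iic x).mul_const B) ?_
      filter_upwards with y
      rw [Real.norm_eq_abs, abs_mul, Real.abs_exp]
      gcongr
      exact hB y
    rw [integral_mul_const, integral_exp_Iic, Real.norm_eq_abs] at this
    simp only [hP]
    rw [abs_mul, Real.abs_exp]
    calc _ ≤ Real.exp (-x) * (Real.exp x * B) := by gcongr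
      _ = B := by rw [← mul_assoc, ← Real.exp_add]; simp
  have hQB : ∀ x, |Q x| ≤ B := by
    intro x
    have : ‖∫ y in Set.Ioi x, Real.exp (-y) * F y‖ ≤ ∫ y in Set.Ioi x, Real.exp (-y) * B := by
      refine norm_integral_le_of_norm_le ((integrableOn_exp_neg_Ioi x).mul_const B) ?_
      filter_upwards with y
      rw [Real.norm_eq_abs, abs_mul, Real.abs_exp]
      gcongr
      exact hB y
    rw [integral_mul_const, integral_exp_neg_Ioi, Real.norm_eq_abs] at this
    simp only [hQ]
    rw [abs_mul, Real.abs_exp]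
    calc _ ≤ Real.exp x * (Real.exp (-x) * B) := by gcongr
      _ = B := by rw [← mul_assoc, ← Real.exp_add]; simp
  have hPd : ∀ x, HasDerivAt P (F x - P x) x := by
    intro x
    have c1 : Continuous fun y => Real.exp y * F y := by fun_prop
    have d1 : HasDerivAt (fun x => ∫ y in Set.Iic x, Real.exp y * F y) (Real.exp x * F x) x := by
      have : (fun x => ∫ y in Set.Iic x, Real.exp y * F y) = fun x =>
          (∫ y in Set.Iic (0:ℝ), Real.exp y * F y) + ∫ y in (0:ℝ)..x, Real.exp y * F y := by
        ext x
        rw [← intervalIntegral.integral_Iic_sub_Iic (expF_intOn_Iic hm hB 0)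
          (expF_intOn_Iic hm hB x)]
        ring
      rw [this]
      exact (c1.integral_hasStrictDerivAt 0 x).hasDerivAt.const_add _
    have d2 : HasDerivAt (fun x : ℝ => Real.exp (-x)) (-Real.exp (-x)) x := by
      simpa using (hasDerivAt_neg x).exp
    refine HasDerivAt.congr_deriv (d2.mul d1) ?_
    have : Real.exp (-x) * Real.exp x = 1 := by rw [← Real.exp_add]; simp
    simp only [hP]
    linear_combination (F x) * this
  have hQd : ∀ x, HasDerivAt Q (Q x - F x) x := by
    intro x
    have c1 : Continuous fun y => Real.exp (-y) * F y := by fun_prop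
    have d1 : HasDerivAt (fun x => ∫ y in Set.Ioi x, Real.exp (-y) * F y) (-(Real.exp (-x) * F x)) x := by
      have : (fun x => ∫ y in Set.Ioi x, Real.exp (-y) * F y) = fun x =>
          (∫ y in Set.Ioi (0:ℝ), Real.exp (-y) * F y) - ∫ y in (0:ℝ)..x, Real.exp (-y) * F y := by
        ext x
        rcases le_total 0 x with h | h
        · rw [← intervalIntegral.integral_Ioi_sub_Ioi (expF_intOn_Ioi hm hB 0) h]
          ring
        · rw [intervalIntegral.integral_symm,
            ← intervalIntegral.integral_Ioi_sub_Ioi (expF_intOn_Ioi hm hB x) h]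
          ring
      rw [this]
      exact (c1.integral_hasStrictDerivAt 0 x).hasDerivAt.const_sub _
    refine HasDerivAt.congr_deriv ((Real.hasDerivAt_exp x).mul d1) ?_
    have : Real.exp x * Real.exp (-x) = 1 := by rw [← Real.exp_add]; simp
    simp only [hQ]
    linear_combination (0 - F x) * this
  refine ⟨fun x => (P x + Q x) / 2, ?_, ?_, ?_, ?_⟩
  · intro x
    simp_rw [hH]
    refine HasDerivAt.congr_deriv (((hQd x).sub (hPd x)).div_const 2) ?_
    ring
  · intro x
    rw [hH]
    refine HasDerivAt.congr_deriv (((hPd x).add (hQd x)).div_const 2) ?_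
    ring
  · intro x
    rw [hH]
    have a := abs_le.1 (hPB x)
    have b := abs_le.1 (hQB x)
    rw [abs_le]; constructor <;> linarith
  · intro x
    have a := abs_le.1 (hPB x)
    have b := abs_le.1 (hQB x)
    show |(P x + Q x) / 2| ≤ B
    rw [abs_le]; constructor <;> linarith

lemma measurable_bbmK : Measurable bbmK := by
  unfold bbmK
  have : Measurable Real.sign := by
    unfold Real.sign
    exact Measurable.ite measurableSet_Iio measurable_const
      (Measurable.ite measurableSet_Ioi measurable_const measurable_const)
  fun_prop

lemma fubini {f : ℝ → ℝ → ℝ} {A : ℝ} (hc : Continuous (Function.uncurry f))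
    (hA : ∀ s y, |f s y| ≤ A) (t x : ℝ) :
    ∫ s in (0:ℝ)..t, ∫ y, bbmK (x - y) * f s y = ∫ y, bbmK (x - y) * ∫ s in (0:ℝ)..t, f s y := by
  rw [intervalIntegral_integral_swap]
  · simp_rw [intervalIntegral.integral_const_mul]
  have h1 : Integrable (fun y => bbmK (x - y) * (1:ℝ)) :=
    bbmK_integrable (B := 1) measurable_const (by simp) x
  have h2 : Integrable (fun _ : ℝ => A) (volume.restrict (Set.uIoc 0 t)) :=
    integrableOn_const (by simp [Set.uIoc])
  have h3 := h2.mul_prod h1.norm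
  have hK := measurable_bbmK
  have hm := hc.measurable
  refine Integrable.mono' h3 ?_ ?_
  · refine Measurable.aestronglyMeasurable ?_
    exact (hK.comp (measurable_const.sub measurable_snd)).mul hm
  · filter_upwards with p
    simp only [Function.uncurry, norm_mul, mul_one]
    rw [mul_comm]
    gcongr
    exact hA _ _

lemma HB_int {k : ℕ} {θ A : ℝ} {f : ℝ → ℝ → ℝ} (hc : Continuous (Function.uncurry f))
    (hf : ∀ s, HB k θ A (f s)) (t : ℝ) :
    HB k θ (|t| * A) (fun y => ∫ s in (0:ℝ)..t, f s y) := by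
  have hA := (hf 0).nonneg
  have hmeas : ∀ j ≤ k, ∀ x, Measurable (fun s => iteratedDeriv j (f s) x) := by
    intro j
    induction j with
    | zero =>
      intro _ x
      simp only [iteratedDeriv_zero]
      exact (hc.comp (Continuous.prodMk_left x)).measurable
    | succ j ih =>
      intro hj x
      have hseq : Filter.Tendsto (fun n : ℕ => (1 / ((n:ℝ) + 1))) Filter.atTop (nhdsWithin 0 {0}ᶜ) := by
        refine tendsto_nhdsWithin_iff.2 ⟨tendsto_one_div_add_atTop_nhds_zero_nat, ?_⟩
        filter_upwards with n
        simp only [Set.mem_compl_iff, Set.mem_singleton_iff]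
        positivity
      refine measurable_of_tendsto_metrizable (f := fun (n : ℕ) s => (1 / ((n:ℝ) + 1))⁻¹ •
        (iteratedDeriv j (f s) (x + 1 / ((n:ℝ) + 1)) - iteratedDeriv j (f s) x)) ?_ ?_
      · intro n
        exact ((ih (by omega) _).sub (ih (by omega) _)).const_smul (1 / ((n:ℝ) + 1))⁻¹
      · refine tendsto_pi_nhds.2 fun s => ?_
        have hd : HasDerivAt (iteratedDeriv j (f s)) (iteratedDeriv (j + 1) (f s) x) x := by
          rw [iteratedDeriv_succ]
          exact ((hf s).1.differentiable_iteratedDeriv j (by exact_mod_cast hj) x).hasDerivAt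
        exact hd.tendsto_slope_zero.comp hseq
  have hint : ∀ j ≤ k, ∀ x, IntervalIntegrable (fun s => iteratedDeriv j (f s) x) volume 0 t := by
    intro j hj x
    refine (intervalIntegrable_const (c := A)).mono_fun (hmeas j hj x).aestronglyMeasurable ?_
    filter_upwards with s
    rw [Real.norm_eq_abs, Real.norm_eq_abs, abs_of_nonneg hA]
    exact (hf s).2.1 j hj x
  have hder : ∀ j, j + 1 ≤ k → ∀ x, HasDerivAt (fun x => ∫ s in (0:ℝ)..t, iteratedDeriv j (f s) x)
      (∫ s in (0:ℝ)..t, iteratedDeriv (j + 1) (f s) x) x := by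
    intro j hj x
    refine (intervalIntegral.hasDerivAt_integral_of_dominated_loc_of_deriv_le (𝕜 := ℝ)
      (F := fun x s => iteratedDeriv j (f s) x) (F' := fun x s => iteratedDeriv (j + 1) (f s) x)
      (bound := fun _ => A) (s := Set.univ) Filter.univ_mem ?_ (hint j (by omega) x)
      (hmeas _ hj x).aestronglyMeasurable ?_ intervalIntegrable_const ?_).2
    · exact Filter.Eventually.of_forall fun y => (hmeas j (by omega) y).aestronglyMeasurable
    · filter_upwards with s _ y _
      exact (hf s).2.1 _ hj y
    · filter_upwards with s _ y _
      rw [iteratedDeriv_succ]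
      exact ((hf s).1.differentiable_iteratedDeriv j (by exact_mod_cast hj) y).hasDerivAt
  have hit : ∀ j ≤ k, iteratedDeriv j (fun y => ∫ s in (0:ℝ)..t, f s y) =
      fun x => ∫ s in (0:ℝ)..t, iteratedDeriv j (f s) x := by
    intro j
    induction j with
    | zero => intro _; simp
    | succ j ih =>
      intro hj
      rw [iteratedDeriv_succ, ih (by omega)]
      exact funext fun x => (hder j hj x).deriv
  refine ⟨?_, ?_, ?_⟩
  · rw [contDiff_nat_iff_iteratedDeriv]
    constructor
    · intro m hm
      rw [hit m hm]
      refine continuous_iff_continuousAt.2 fun x => ?_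
      refine intervalIntegral.continuousAt_of_dominated_interval (bound := fun _ => A) ?_ ?_
        intervalIntegrable_const ?_
      · exact Filter.Eventually.of_forall fun y => (hmeas m hm y).aestronglyMeasurable
      · refine Filter.Eventually.of_forall fun y => ?_
        filter_upwards with s _
        exact (hf s).2.1 _ hm y
      · filter_upwards with s _
        exact ((hf s).1.continuous_iteratedDeriv m (by exact_mod_cast hm)).continuousAt
    · intro m hm
      rw [hit m hm.le]
      exact fun x => (hder m hm x).differentiableAt
  · intro j hj x
    rw [hit j hj]
    have := intervalIntegral.norm_integral_le_of_norm_le_const (a := 0) (b := t) (C := A)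
      (f := fun s => iteratedDeriv j (f s) x) (fun s _ => (hf s).2.1 j hj x)
    rw [sub_zero, mul_comm] at this
    exact this
  · intro x y
    rw [hit k le_rfl]
    simp only
    rw [← intervalIntegral.integral_sub (hint k le_rfl x) (hint k le_rfl y)]
    have := intervalIntegral.norm_integral_le_of_norm_le_const (a := 0) (b := t)
      (C := A * |x - y| ^ θ)
      (f := fun s => iteratedDeriv k (f s) x - iteratedDeriv k (f s) y) (fun s _ => (hf s).2.2 x y)
    rw [sub_zero, Real.norm_eq_abs] at this
    linarith

/-- Gain of one derivative for BBM solutions in Hölder classes: there is `c = c(k,θ) > 0`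
such that for any continuous solution `u` of the BBM integral equation on `ℝ × [-T,T]` with
data `u₀ ∈ C^{k,θ}(ℝ)` and `sup_{|t|≤T} ‖u(·,t)‖_{C^{k,θ}} ≤ M`, the difference
`u(·,t) - u₀` lies in `C^{k+1,θ}(ℝ)` with `‖u(·,t) - u₀‖_{C^{k+1,θ}} ≤ c |t| (M + M²)`. -/
theorem bbm_holder_gain_of_regularity (k : ℕ) (θ : ℝ) (hθ0 : 0 ≤ θ) (hθ1 : θ ≤ 1) :
    ∃ c : ℝ, 0 < c ∧ ∀ (T : ℝ), 0 < T → ∀ (u₀ : ℝ → ℝ), MemHolderClass k θ u₀ →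
      ∀ (u : ℝ → ℝ → ℝ),
        ContinuousOn (fun p : ℝ × ℝ => u p.1 p.2) (Set.univ ×ˢ Set.Icc (-T) T) →
        (∀ t ∈ Set.Icc (-T) T, MemHolderClass k θ (fun x => u x t)) →
        ∀ M : ℝ, (∀ t ∈ Set.Icc (-T) T, holderNorm k θ (fun x => u x t) ≤ M) →
        (∀ x : ℝ, ∀ t ∈ Set.Icc (-T) T,
          u x t = u₀ x -
            ∫ t' in (0:ℝ)..t, ∫ y : ℝ, bbmK (x - y) * (u y t' + u y t' ^ 2 / 2)) →
        ∀ t ∈ Set.Icc (-T) T,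
          MemHolderClass (k + 1) θ (fun x => u x t - u₀ x) ∧
          holderNorm (k + 1) θ (fun x => u x t - u₀ x) ≤ c * |t| * (M + M ^ 2) := by
  refine ⟨(k + 3) * ((2 * k + 5) * 2 ^ (k + 1)), by positivity, ?_⟩
  intro T hT u₀ _ u hu hmem M hM heq t ht
  have hTT : -T ≤ T := by linarith
  set p : ℝ → ℝ := fun s => (Set.projIcc (-T) T hTT s : ℝ) with hp
  have hpm : ∀ s, p s ∈ Set.Icc (-T) T := fun s => (Set.projIcc (-T) T hTT s).2
  have hpc : Continuous p := continuous_subtype_val.comp continuous_projIcc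
  have hpe : ∀ s ∈ Set.Icc (-T) T, p s = s := fun s hs => by
    simp only [hp, Set.projIcc_of_mem hTT hs]
  set f : ℝ → ℝ → ℝ := fun s y => u y (p s) + u y (p s) ^ 2 / 2 with hf
  have huc : Continuous fun q : ℝ × ℝ => u q.2 (p q.1) :=
    hu.comp_continuous (f := fun q : ℝ × ℝ => (q.2, p q.1)) (by fun_prop)
      (fun q => ⟨trivial, hpm _⟩)
  have hfc : Continuous (Function.uncurry f) := huc.add ((huc.pow 2).div_const 2)
  have hfB : ∀ s, HB k θ (2 ^ (k + 1) * (M + M ^ 2)) (f s) := fun s =>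
    HB_nonlin hθ0 hθ1 (HB_of_mem (hmem _ (hpm s)) (hM _ (hpm s)))
  have hF := HB_int hfc hfB t
  obtain ⟨W, w1, w2, w3, w4⟩ := conv_exists hF.1.continuous
    (fun x => by simpa using hF.2.1 0 (Nat.zero_le _) x)
  have hH := HB_conv hθ0 hθ1 hF w1 w2 w3 w4
  have hdiff : ∀ x, u x t - u₀ x = -∫ y, bbmK (x - y) * ∫ s in (0:ℝ)..t, f s y := by
    intro x
    rw [← fubini hfc (fun s y => by simpa using (hfB s).2.1 0 (Nat.zero_le _) y), heq x t ht]
    have : ∫ s in (0:ℝ)..t, ∫ y, bbmK (x - y) * f s y =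
        ∫ t' in (0:ℝ)..t, ∫ y : ℝ, bbmK (x - y) * (u y t' + u y t' ^ 2 / 2) := by
      refine intervalIntegral.integral_congr fun s hs => ?_
      have hs' : s ∈ Set.Icc (-T) T :=
        Set.uIcc_subset_Icc ⟨by linarith, by linarith⟩ ht hs
      simp only [hf, hpe s hs']
    rw [this]
    ring
  have hneg : HB (k + 1) θ ((2 * k + 5) * (|t| * (2 ^ (k + 1) * (M + M ^ 2))))
      (fun x => u x t - u₀ x) := by
    simp_rw [hdiff]
    obtain ⟨a, b, c⟩ := hH
    refine ⟨a.neg, ?_, ?_⟩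
    · intro j hj x
      rw [iteratedDeriv_fun_neg, abs_neg]
      exact b j hj x
    · intro x y
      rw [iteratedDeriv_fun_neg, iteratedDeriv_fun_neg, neg_sub_neg, abs_sub_comm]
      exact c x y
  obtain ⟨r1, r2⟩ := hneg.mem
  refine ⟨r1, r2.trans (le_of_eq ?_)⟩
  push_cast
  ring
end
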